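/- arXiv:2208.06574 — 2 statements merged into one kernel-verified Lean document; each statement's English description precedes it below -/
import Mathlib

section
/- A compact hyponormal operator on a complex Hilbert space is normal. -/
open ContinuousLinearMap

namespace Hyponormal

variable {H : Type*} [NormedAddCommGroup H] [InnerProductSpace ℂ H] [CompleteSpace H]

theorem norm_adjoint_apply_le {T : H →L[ℂ] H}
    (hT : (adjoint T ∘L T - T ∘L adjoint T).IsPositive) (x : H) :
    ‖adjoint T x‖ ≤ ‖T x‖ := by
  have h := hT.re_inner_nonneg_left x
  have h₁ : inner ℂ (adjoint T (T x)) x = inner ℂ (T x) (T x) := adjoint_inner_left T x (T x)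
  have h₂ : inner ℂ (T (adjoint T x)) x = inner ℂ (adjoint T x) (adjoint T x) :=
    (adjoint_inner_right T (adjoint T x) x).symm
  rw [sub_apply, comp_apply, comp_apply, inner_sub_left, h₁, h₂, map_sub,
    inner_self_eq_norm_sq, inner_self_eq_norm_sq] at h
  exact le_of_sq_le_sq (by linarith) (norm_nonneg _)

theorem adjoint_apply_of_apply_eq_smul {T : H →L[ℂ] H} (hT : ∀ x, ‖adjoint T x‖ ≤ ‖T x‖)
    {μ : ℂ} {x : H} (hx : T x = μ • x) : adjoint T x = (starRingEnd ℂ) μ • x := by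
  have h₁ : inner ℂ (adjoint T x) ((starRingEnd ℂ) μ • x) = ((‖μ‖ ^ 2 * ‖x‖ ^ 2 : ℝ) : ℂ) := by
    rw [inner_smul_right, adjoint_inner_left, hx, inner_smul_right, inner_self_eq_norm_sq_to_K,
      ← mul_assoc, Complex.conj_mul']
    push_cast
    rfl
  have h₂ := norm_sub_sq (𝕜 := ℂ) (adjoint T x) ((starRingEnd ℂ) μ • x)
  rw [h₁] at h₂
  have h₃ : ‖adjoint T x‖ ^ 2 ≤ (‖μ‖ * ‖x‖) ^ 2 := by
    have := hT x
    rw [hx, norm_smul] at this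
    gcongr
  have h_re : RCLike.re ((‖μ‖ ^ 2 * ‖x‖ ^ 2 : ℝ) : ℂ) = ‖μ‖ ^ 2 * ‖x‖ ^ 2 := Complex.ofReal_re _
  rw [h_re, norm_smul, RCLike.norm_conj] at h₂
  have h₄ : ‖adjoint T x - (starRingEnd ℂ) μ • x‖ ^ 2 ≤ 0 := by nlinarith
  exact sub_eq_zero.1 (norm_eq_zero.1 (pow_eq_zero_iff two_ne_zero |>.1
    (le_antisymm h₄ (sq_nonneg _))))

theorem norm_pow_succ_sq_le {T : H →L[ℂ] H} (hT : ∀ x, ‖adjoint T x‖ ≤ ‖T x‖) (n : ℕ) :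
    ‖T ^ (n + 1)‖ ^ 2 ≤ ‖T ^ (n + 2)‖ * ‖T ^ n‖ := by
  have key : ∀ x, ‖(T ^ (n + 1)) x‖ ≤ √(‖T ^ (n + 2)‖ * ‖T ^ n‖) * ‖x‖ := fun x ↦ by
    rw [← Real.sqrt_sq (norm_nonneg x), ← Real.sqrt_mul (by positivity)]
    apply Real.le_sqrt_of_sq_le
    have e₁ : (T ^ (n + 1)) x = T ((T ^ n) x) := by rw [pow_succ']; rfl
    have e₂ : (T ^ (n + 2)) x = T ((T ^ (n + 1)) x) := by rw [pow_succ' T (n + 1)]; rfl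
    calc ‖(T ^ (n + 1)) x‖ ^ 2
        = ‖inner ℂ (adjoint T ((T ^ (n + 1)) x)) ((T ^ n) x)‖ := by
          rw [adjoint_inner_left, ← e₁, inner_self_eq_norm_sq_to_K]
          simp
      _ ≤ ‖adjoint T ((T ^ (n + 1)) x)‖ * ‖(T ^ n) x‖ := norm_inner_le_norm _ _
      _ ≤ ‖(T ^ (n + 2)) x‖ * ‖(T ^ n) x‖ := by
          rw [e₂]
          gcongr
          exact hT _
      _ ≤ (‖T ^ (n + 2)‖ * ‖x‖) * (‖T ^ n‖ * ‖x‖) := by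
          gcongr <;> exact le_opNorm _ _
      _ = ‖T ^ (n + 2)‖ * ‖T ^ n‖ * ‖x‖ ^ 2 := by ring
  calc ‖T ^ (n + 1)‖ ^ 2 ≤ √(‖T ^ (n + 2)‖ * ‖T ^ n‖) ^ 2 := by
        gcongr
        exact opNorm_le_bound _ (Real.sqrt_nonneg _) key
    _ = _ := Real.sq_sqrt (by positivity)

theorem pow_norm_le_norm_pow {T : H →L[ℂ] H} (hT : ∀ x, ‖adjoint T x‖ ≤ ‖T x‖) (n : ℕ) :
    ‖T‖ ^ (n + 1) ≤ ‖T ^ (n + 1)‖ := by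
  rcases (norm_nonneg T).eq_or_lt with h₀ | h₀
  · rw [← h₀, zero_pow n.succ_ne_zero]
    exact norm_nonneg _
  induction n with
  | zero => simp
  | succ n ih =>
    have h₁ := norm_pow_succ_sq_le hT n
    have h₂ : ‖T ^ n‖ ≤ ‖T‖ ^ n := by
      rcases n.eq_zero_or_pos with rfl | hn
      · rw [pow_zero, pow_zero]
        exact norm_id_le
      · exact norm_pow_le' T hn
    have h₃ : ‖T‖ ^ (n + 2) * ‖T‖ ^ n ≤ ‖T ^ (n + 2)‖ * ‖T‖ ^ n := calc
      _ = (‖T‖ ^ (n + 1)) ^ 2 := by ring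
      _ ≤ ‖T ^ (n + 1)‖ ^ 2 := by gcongr
      _ ≤ ‖T ^ (n + 2)‖ * ‖T ^ n‖ := h₁
      _ ≤ _ := by gcongr
    exact le_of_mul_le_mul_right h₃ (by positivity)

theorem nnnorm_le_spectralRadius {T : H →L[ℂ] H} (hT : ∀ x, ‖adjoint T x‖ ≤ ‖T x‖) :
    (‖T‖₊ : ENNReal) ≤ spectralRadius ℂ T := by
  refine ge_of_tendsto (spectrum.pow_nnnorm_pow_one_div_tendsto_nhds_spectralRadius T) ?_
  filter_upwards [Filter.eventually_ge_atTop 1] with n hn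
  obtain ⟨m, rfl⟩ := Nat.exists_eq_add_of_le' hn
  rw [one_div, ENNReal.le_rpow_inv_iff (by positivity), ENNReal.rpow_natCast]
  exact_mod_cast pow_norm_le_norm_pow hT m

theorem eq_zero_of_isCompactOperator {T : H →L[ℂ] H} (hT : ∀ x, ‖adjoint T x‖ ≤ ‖T x‖)
    (hc : IsCompactOperator T) (h : ∀ μ : ℂ, μ ≠ 0 → ∀ x, T x = μ • x → x = 0) : T = 0 := by
  have hs : spectralRadius ℂ T = 0 := by
    simp only [spectralRadius, ENNReal.iSup_eq_zero, ENNReal.coe_eq_zero, nnnorm_eq_zero]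
    intro μ hμ
    by_contra h₀
    obtain ⟨x, hx⟩ := ((hc.hasEigenvalue_iff_mem_spectrum h₀).2 hμ).exists_hasEigenvector
    exact hx.2 (h μ h₀ x hx.apply_eq_smul)
  have := nnnorm_le_spectralRadius hT
  rw [hs] at this
  simpa using this

theorem starProjection_apply_comm {T : H →L[ℂ] H} {N : Submodule ℂ H}
    [N.HasOrthogonalProjection] (h₁ : ∀ x ∈ N, T x ∈ N) (h₂ : ∀ x ∈ N, adjoint T x ∈ N) (x : H) :
    N.starProjection (T x) = T (N.starProjection x) := by
  refine Submodule.eq_starProjection_of_mem_of_inner_eq_zero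
    (h₁ _ (N.starProjection_apply_mem x)) fun w hw ↦ ?_
  rw [← map_sub, ← adjoint_inner_right]
  exact N.starProjection_inner_eq_zero x _ (h₂ w hw)

theorem apply_mem_orthogonal {T : H →L[ℂ] H} {M : Submodule ℂ H}
    (h : ∀ x ∈ M, adjoint T x ∈ M) : ∀ x ∈ Mᗮ, T x ∈ Mᗮ := fun x hx y hy ↦ by
  rw [← adjoint_inner_left]
  exact hx _ (h y hy)

theorem orthogonal_iSup_eigenspace_eq_bot {T : H →L[ℂ] H} (hT : ∀ x, ‖adjoint T x‖ ≤ ‖T x‖)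
    (hc : IsCompactOperator T) :
    (⨆ μ : ℂ, Module.End.eigenspace (T : Module.End ℂ H) μ)ᗮ = ⊥ := by
  set M := ⨆ μ : ℂ, Module.End.eigenspace (T : Module.End ℂ H) μ with hM
  have mem_M : ∀ {μ : ℂ} {x : H}, T x = μ • x → x ∈ M := fun {μ x} hx ↦
    Submodule.mem_iSup_of_mem μ (Module.End.mem_eigenspace_iff.2 hx)
  have hM₁ : ∀ x ∈ M, T x ∈ M := fun x hx ↦ by
    induction hx using Submodule.iSup_induction' with
    | mem μ x hx =>
      have hx : T x = μ • x := Module.End.mem_eigenspace_iff.1 hx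
      rw [hx]
      exact M.smul_mem _ (mem_M hx)
    | zero => simp
    | add x y _ _ hx hy => rw [map_add]; exact M.add_mem hx hy
  have hM₂ : ∀ x ∈ M, adjoint T x ∈ M := fun x hx ↦ by
    induction hx using Submodule.iSup_induction' with
    | mem μ x hx =>
      have hx : T x = μ • x := Module.End.mem_eigenspace_iff.1 hx
      rw [adjoint_apply_of_apply_eq_smul hT hx]
      exact M.smul_mem _ (mem_M hx)
    | zero => simp
    | add x y _ _ hx hy => rw [map_add]; exact M.add_mem hx hy
  have hN₁ := apply_mem_orthogonal hM₂
  have hN₂ : ∀ x ∈ Mᗮ, adjoint T x ∈ Mᗮ :=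
    apply_mem_orthogonal (by simpa only [adjoint_adjoint] using hM₁)
  have eq_zero : ∀ x ∈ Mᗮ, x ∈ M → x = 0 := fun x hx hx' ↦ inner_self_eq_zero.1 (hx x hx')
  have hP : T ∘L Mᗮ.starProjection = 0 := by
    refine eq_zero_of_isCompactOperator (fun x ↦ ?_) (hc.comp_clm _) fun μ hμ x hx ↦ ?_
    · rw [adjoint_comp, (isSelfAdjoint_starProjection Mᗮ).adjoint_eq, comp_apply, comp_apply,
        starProjection_apply_comm hN₂ (by simpa only [adjoint_adjoint] using hN₁)]
      exact hT _
    · rw [comp_apply] at hx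
      have hxN : x ∈ Mᗮ := by
        rw [← inv_smul_smul₀ hμ x, ← hx]
        exact Submodule.smul_mem _ _ (hN₁ _ (Submodule.starProjection_apply_mem _ x))
      rw [Submodule.starProjection_eq_self_iff.2 hxN] at hx
      exact eq_zero x hxN (mem_M hx)
  refine (Submodule.eq_bot_iff _).2 fun x hx ↦ eq_zero x hx (mem_M (μ := 0) ?_)
  have := DFunLike.congr_fun hP x
  rw [comp_apply, Submodule.starProjection_eq_self_iff.2 hx] at this
  simpa using this

end Hyponormal

/-- A compact hyponormal operator on a complex Hilbert space is normal. -/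
theorem stmt_11 {H : Type*} [NormedAddCommGroup H] [InnerProductSpace ℂ H]
    [CompleteSpace H] (T : H →L[ℂ] H) (hcpt : IsCompactOperator ⇑T)
    (hhypo : (adjoint T ∘L T - T ∘L adjoint T).IsPositive) :
    T ∘L adjoint T = adjoint T ∘L T := by
  have hT := Hyponormal.norm_adjoint_apply_le hhypo
  have hdense := Submodule.dense_iff_topologicalClosure_eq_top.2
    ((Submodule.topologicalClosure_eq_top_iff).2
      (Hyponormal.orthogonal_iSup_eigenspace_eq_bot hT hcpt))
  refine DFunLike.coe_injective (Continuous.ext_on hdense (map_continuous _) (map_continuous _) ?_)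
  intro x hx
  induction hx using Submodule.iSup_induction' with
  | mem μ x hx =>
    have hx : T x = μ • x := Module.End.mem_eigenspace_iff.1 hx
    have hx' := Hyponormal.adjoint_apply_of_apply_eq_smul hT hx
    rw [comp_apply, comp_apply, hx, hx', map_smul, map_smul, hx, hx', smul_comm]
  | zero => simp
  | add x y _ _ hx hy => rw [map_add, map_add, hx, hy]
end

section
/- If T is a hyponormal bounded operator on a Hilbert space whose spectrum has planar Lebesgue measure zero, then T is normal. -/
open ContinuousLinearMap MeasureTheory

universe u

theorem sum_norm_sq_sub_norm_adjoint_sq_le_of_orthonormalBasis {E κ : Type*}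
    [NormedAddCommGroup E] [InnerProductSpace ℂ E] [CompleteSpace E] [Fintype κ]
    (A : E →L[ℂ] E) (L : Submodule ℂ E) [L.HasOrthogonalProjection] (z : E)
    (hL : ∀ y ∈ L, A y ∈ L ⊔ Submodule.span ℂ {z}) (f : OrthonormalBasis κ ℂ L) :
    ∑ k, (‖A (f k)‖ ^ 2 - ‖adjoint A (f k)‖ ^ 2) ≤ ‖A‖ ^ 2 := by
  set g : E := Lᗮ.starProjection z with hg
  set h : E := ((‖g‖⁻¹ : ℝ) : ℂ) • g with hh
  have hgL : g ∈ Lᗮ := Submodule.starProjection_apply_mem _ _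
  have hhL : h ∈ Lᗮ := Submodule.smul_mem _ _ hgL
  have hnorm : ‖h‖ ≤ 1 := by
    rw [hh, norm_smul, Complex.norm_real, norm_inv, norm_norm]
    exact inv_mul_le_one
  have hinner : ‖inner ℂ h g‖ = ‖g‖ := by
    rw [hh, inner_smul_left, inner_self_eq_norm_sq_to_K]
    rcases eq_or_ne ‖g‖ 0 with h0 | h0
    · simp [h0]
    · simp only [Complex.conj_ofReal, norm_mul, Complex.norm_real, norm_inv, norm_norm,
        Complex.coe_algebraMap, norm_pow]
      field_simp
  have hfo : Orthonormal ℂ (fun k => (f k : E)) :=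
    f.orthonormal.comp_linearIsometry L.subtypeₗᵢ
  have hQ : ∀ k, ‖Lᗮ.starProjection (A (f k))‖ = ‖inner ℂ (f k : E) (adjoint A h)‖ := by
    intro k
    obtain ⟨l, hl, w, hw, hlw⟩ := Submodule.mem_sup.1 (hL _ (f k).2)
    obtain ⟨c, rfl⟩ := Submodule.mem_span_singleton.1 hw
    have hl0 : Lᗮ.starProjection l = 0 :=
      (Submodule.starProjection_apply_eq_zero_iff _).2 (Submodule.le_orthogonal_orthogonal _ hl)
    have h1 : Lᗮ.starProjection (A (f k)) = c • g := by
      rw [← hlw, map_add, map_smul, hl0, zero_add]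
    rw [adjoint_inner_right, ← inner_conj_symm, RCLike.norm_conj]
    have h2 : inner ℂ h (A (f k)) = c * inner ℂ h g := by
      rw [← inner_smul_right, ← h1]
      conv_lhs => rw [← Submodule.starProjection_eq_self_iff.2 hhL]
      rw [Submodule.inner_starProjection_left_eq_right]
    rw [h1, h2, norm_smul, norm_mul, hinner]
  have hP : ∀ y : E, ‖L.starProjection y‖ ^ 2 = ∑ k, ‖inner ℂ (f k : E) y‖ ^ 2 := by
    intro y
    rw [Submodule.starProjection_apply, ← Submodule.coe_norm, ← f.sum_sq_norm_inner_right]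
    refine Finset.sum_congr rfl fun k _ => ?_
    rw [Submodule.inner_orthogonalProjectionOnto_eq_of_mem_left]
  have hswap : ∑ k, ‖L.starProjection (A (f k))‖ ^ 2
      = ∑ k, ‖L.starProjection (adjoint A (f k))‖ ^ 2 := by
    simp_rw [hP]
    rw [Finset.sum_comm]
    refine Finset.sum_congr rfl fun k _ => Finset.sum_congr rfl fun l _ => ?_
    rw [adjoint_inner_right, ← inner_conj_symm, RCLike.norm_conj]
  calc ∑ k, (‖A (f k)‖ ^ 2 - ‖adjoint A (f k)‖ ^ 2)
      ≤ ∑ k, (‖L.starProjection (A (f k))‖ ^ 2 - ‖L.starProjection (adjoint A (f k))‖ ^ 2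
          + ‖inner ℂ (f k : E) (adjoint A h)‖ ^ 2) := by
        refine Finset.sum_le_sum fun k _ => ?_
        rw [← hQ, Submodule.norm_sq_eq_add_norm_sq_starProjection (A (f k)) L,
          Submodule.norm_sq_eq_add_norm_sq_starProjection (adjoint A (f k)) L]
        nlinarith [sq_nonneg ‖Lᗮ.starProjection (adjoint A (f k))‖]
    _ = ∑ k, ‖inner ℂ (f k : E) (adjoint A h)‖ ^ 2 := by
        rw [Finset.sum_add_distrib, Finset.sum_sub_distrib, hswap, sub_self, zero_add]
    _ ≤ ‖adjoint A h‖ ^ 2 := hfo.sum_inner_products_le _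
    _ ≤ ‖A‖ ^ 2 := by
        gcongr
        calc ‖adjoint A h‖ ≤ ‖adjoint A‖ * ‖h‖ := le_opNorm _ _
          _ ≤ ‖adjoint A‖ * 1 := by gcongr
          _ = ‖A‖ := by rw [mul_one, LinearIsometryEquiv.norm_map]

theorem sum_norm_sq_sub_norm_adjoint_sq_starProjection_le {E ι : Type*}
    [NormedAddCommGroup E] [InnerProductSpace ℂ E] [CompleteSpace E] [Fintype ι]
    (A : E →L[ℂ] E) (hA : ∀ y, ‖adjoint A y‖ ≤ ‖A y‖)
    (L : Submodule ℂ E) [FiniteDimensional ℂ L] (z : E)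
    (hL : ∀ y ∈ L, A y ∈ L ⊔ Submodule.span ℂ {z}) {u : ι → E} (hu : Orthonormal ℂ u) :
    ∑ i, (‖A (L.starProjection (u i))‖ ^ 2 - ‖adjoint A (L.starProjection (u i))‖ ^ 2)
      ≤ ‖A‖ ^ 2 := by
  let D : L →ₗ[ℂ] L := (L.orthogonalProjectionOnto.toLinearMap ∘ₗ
    (adjoint A ∘L A - A ∘L adjoint A).toLinearMap) ∘ₗ L.subtype
  have hD : ∀ x y : L, inner ℂ x (D y)
      = inner ℂ (A x) (A y) - inner ℂ (adjoint A x) (adjoint A (y : E)) := by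
    intro x y
    have : inner ℂ x (D y) = inner ℂ (x : E) ((adjoint A ∘L A - A ∘L adjoint A) (y : E)) :=
      Submodule.inner_orthogonalProjectionOnto_eq_of_mem_left _ _
    rw [this, sub_apply, inner_sub_right, comp_apply, comp_apply, adjoint_inner_right,
      ← adjoint_inner_left A (adjoint A (y : E)) (x : E)]
  have hsymm : D.IsSymmetric := by
    intro x y
    rw [hD, ← inner_conj_symm, hD, map_sub, inner_conj_symm, inner_conj_symm]
  have hquad : ∀ y : L, inner ℂ y (D y)
      = ((‖A y‖ ^ 2 - ‖adjoint A (y : E)‖ ^ 2 : ℝ) : ℂ) := by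
    intro y
    rw [hD, inner_self_eq_norm_sq_to_K, inner_self_eq_norm_sq_to_K]
    push_cast
    rfl
  let f := hsymm.eigenvectorBasis rfl
  let ev := hsymm.eigenvalues rfl
  have hev : ∀ k, ev k = ‖A (f k)‖ ^ 2 - ‖adjoint A (f k : E)‖ ^ 2 := by
    intro k
    have h1 := hquad (f k)
    rw [hsymm.apply_eigenvectorBasis, inner_smul_right, inner_self_eq_norm_sq_to_K,
      f.orthonormal.1 k] at h1
    simp only [RCLike.ofReal_one, one_pow, mul_one] at h1
    exact Complex.ofReal_injective h1
  have hev0 : ∀ k, 0 ≤ ev k := fun k => by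
    rw [hev, sub_nonneg]
    gcongr
    exact hA _
  have hexp : ∀ y : L, ‖A y‖ ^ 2 - ‖adjoint A (y : E)‖ ^ 2
      = ∑ k, ev k * ‖inner ℂ (f k) y‖ ^ 2 := by
    intro y
    have h1 := hquad y
    rw [← f.sum_inner_mul_inner] at h1
    have h2 : ∀ k, inner ℂ y (f k) * inner ℂ (f k) (D y)
        = ((ev k * ‖inner ℂ (f k) y‖ ^ 2 : ℝ) : ℂ) := by
      intro k
      rw [← hsymm, hsymm.apply_eigenvectorBasis, inner_smul_left, ← inner_conj_symm y (f k)]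
      rw [mul_left_comm, RCLike.conj_mul]
      simp [ev]
    simp_rw [h2] at h1
    exact_mod_cast h1.symm
  calc ∑ i, (‖A (L.starProjection (u i))‖ ^ 2 - ‖adjoint A (L.starProjection (u i))‖ ^ 2)
      = ∑ k, ev k * ∑ i, ‖inner ℂ (u i) (f k : E)‖ ^ 2 := by
        simp_rw [Submodule.starProjection_apply, hexp, Finset.mul_sum]
        rw [Finset.sum_comm]
        refine Finset.sum_congr rfl fun k _ => Finset.sum_congr rfl fun i _ => ?_
        rw [Submodule.inner_orthogonalProjectionOnto_eq_of_mem_left, ← inner_conj_symm,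
          RCLike.norm_conj]
    _ ≤ ∑ k, ev k * 1 := by
        refine Finset.sum_le_sum fun k _ => mul_le_mul_of_nonneg_left ?_ (hev0 k)
        refine (hu.sum_inner_products_le _).trans ?_
        rw [← Submodule.coe_norm, f.orthonormal.1 k, one_pow]
    _ = ∑ k, (‖A (f k)‖ ^ 2 - ‖adjoint A (f k : E)‖ ^ 2) := by simp_rw [mul_one, hev]
    _ ≤ ‖A‖ ^ 2 := sum_norm_sq_sub_norm_adjoint_sq_le_of_orthonormalBasis A L z hL f

theorem sum_norm_sq_sub_norm_adjoint_sq_le_of_approx {E ι : Type*}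
    [NormedAddCommGroup E] [InnerProductSpace ℂ E] [CompleteSpace E] [Fintype ι]
    (A : E →L[ℂ] E) (hA : ∀ y, ‖adjoint A y‖ ≤ ‖A y‖) {u : ι → E} (hu : Orthonormal ℂ u)
    (h : ∀ ε > 0, ∃ w : E, ∀ i, ∃ p : Polynomial ℂ, ‖Polynomial.aeval A p w - u i‖ < ε) :
    ∑ i, (‖A (u i)‖ ^ 2 - ‖adjoint A (u i)‖ ^ 2) ≤ ‖A‖ ^ 2 := by
  have key : ∀ ε > 0, ∃ v : ι → E, (∀ i, ‖v i - u i‖ < ε) ∧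
      ∑ i, (‖A (v i)‖ ^ 2 - ‖adjoint A (v i)‖ ^ 2) ≤ ‖A‖ ^ 2 := by
    intro ε hε
    obtain ⟨w, hw⟩ := h ε hε
    choose p hp using hw
    let n := ∑ i, (p i).natDegree + 1
    let L : Submodule ℂ E := Submodule.span ℂ (Set.range fun m : Fin n => (A ^ (m : ℕ)) w)
    have : FiniteDimensional ℂ L := FiniteDimensional.span_of_finite ℂ (Set.finite_range _)
    have hmem : ∀ m < n, (A ^ m) w ∈ L := fun m hm => Submodule.subset_span ⟨⟨m, hm⟩, rfl⟩
    refine ⟨fun i => L.starProjection (u i), fun i => ?_,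
      sum_norm_sq_sub_norm_adjoint_sq_starProjection_le A hA L ((A ^ n) w) ?_ hu⟩
    · have hpL : Polynomial.aeval A (p i) w ∈ L := by
        have hdeg : (p i).natDegree < n := Nat.lt_succ_of_le
          (Finset.single_le_sum (f := fun i => (p i).natDegree) (fun _ _ => Nat.zero_le _)
            (Finset.mem_univ i))
        rw [Polynomial.aeval_eq_sum_range' hdeg, sum_apply]
        refine Submodule.sum_mem _ fun m hm => ?_
        rw [smul_apply]
        exact Submodule.smul_mem _ _ (hmem m (Finset.mem_range.1 hm))
      refine lt_of_le_of_lt ?_ (hp i)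
      rw [norm_sub_rev, Submodule.starProjection_minimal, norm_sub_rev]
      exact ciInf_le ⟨0, by rintro _ ⟨y, rfl⟩; positivity⟩
        (⟨Polynomial.aeval A (p i) w, hpL⟩ : L)
    · intro y hy
      suffices L ≤ (L ⊔ Submodule.span ℂ {(A ^ n) w}).comap A.toLinearMap from this hy
      refine Submodule.span_le.2 ?_
      rintro _ ⟨m, rfl⟩
      change (A * A ^ (m : ℕ)) w ∈ L ⊔ Submodule.span ℂ {(A ^ n) w}
      rw [← pow_succ']
      rcases Nat.lt_or_ge (m + 1) n with hm | hm
      · exact Submodule.mem_sup_left (hmem _ hm)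
      · rw [le_antisymm m.2 hm]
        exact Submodule.mem_sup_right (Submodule.mem_span_singleton_self _)
  choose! v hv hv' using key
  have hpos : ∀ n : ℕ, (0 : ℝ) < 1 / (n + 1) := fun n => Nat.one_div_pos_of_nat
  have hlim : ∀ i, Filter.Tendsto (fun n : ℕ => v (1 / (n + 1)) i) Filter.atTop (nhds (u i)) := by
    intro i
    rw [tendsto_iff_norm_sub_tendsto_zero]
    exact squeeze_zero (fun _ => norm_nonneg _) (fun n => (hv _ (hpos n) i).le)
      tendsto_one_div_add_atTop_nhds_zero_nat
  refine le_of_tendsto (f := fun n : ℕ => ∑ i, (‖A (v (1 / (n + 1)) i)‖ ^ 2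
    - ‖adjoint A (v (1 / (n + 1)) i)‖ ^ 2)) (x := Filter.atTop) ?_
    (Filter.Eventually.of_forall fun n => hv' _ (hpos n))
  exact tendsto_finsetSum _ fun i _ =>
    ((((A.continuous.tendsto _).comp (hlim i)).norm.pow 2).sub
      ((((adjoint A).continuous.tendsto _).comp (hlim i)).norm.pow 2))

theorem sum_norm_sq_sub_norm_adjoint_sq_le_of_blocks {ι : Type*} [Fintype ι] [DecidableEq ι]
    {G : ι → Type*} [∀ i, NormedAddCommGroup (G i)] [∀ i, InnerProductSpace ℂ (G i)]
    [∀ i, CompleteSpace (G i)] (A : ∀ i, G i →L[ℂ] G i)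
    (hA : ∀ i y, ‖adjoint (A i) y‖ ≤ ‖A i y‖) {R : ℝ} (hR₀ : 0 ≤ R) (hR : ∀ i, ‖A i‖ ≤ R)
    {x : ∀ i, G i} (hx : ∀ i, ‖x i‖ = 1)
    (h : ∀ ε > 0, ∃ w : ∀ i, G i, ∀ i, ∃ p : Polynomial ℂ,
      ∀ k, ‖Polynomial.aeval (A k) p (w k) - Pi.single i (x i) k‖ < ε) :
    ∑ i, (‖A i (x i)‖ ^ 2 - ‖adjoint (A i) (x i)‖ ^ 2) ≤ R ^ 2 := by
  let e := PiLp.continuousLinearEquiv 2 ℂ G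
  let diag (B : ∀ i, G i →L[ℂ] G i) : PiLp 2 G →L[ℂ] PiLp 2 G :=
    e.symm.toContinuousLinearMap ∘L ContinuousLinearMap.piMap B ∘L e.toContinuousLinearMap
  have diag_apply : ∀ B y i, diag B y i = B i (y i) := fun _ _ _ => rfl
  have diag_adjoint : adjoint (diag A) = diag fun i => adjoint (A i) := by
    symm
    rw [eq_adjoint_iff]
    intro y z
    simp_rw [PiLp.inner_apply, diag_apply, adjoint_inner_left]
  have diag_norm : ‖diag A‖ ≤ R := by
    refine opNorm_le_bound _ hR₀ fun y => ?_
    refine le_of_sq_le_sq ?_ (by positivity)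
    rw [mul_pow, PiLp.norm_sq_eq_of_L2, PiLp.norm_sq_eq_of_L2, Finset.mul_sum]
    refine Finset.sum_le_sum fun i _ => ?_
    rw [diag_apply, ← mul_pow]
    gcongr
    exact (A i).le_of_opNorm_le (hR i) _
  have diag_le : ∀ y, ‖adjoint (diag A) y‖ ≤ ‖diag A y‖ := by
    intro y
    refine le_of_sq_le_sq ?_ (by positivity)
    rw [diag_adjoint, PiLp.norm_sq_eq_of_L2, PiLp.norm_sq_eq_of_L2]
    refine Finset.sum_le_sum fun i _ => ?_
    rw [diag_apply, diag_apply]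
    gcongr
    exact hA i _
  have diag_pow : ∀ (m : ℕ) y i, (diag A ^ m) y i = (A i ^ m) (y i) := by
    intro m
    induction m with
    | zero => intro y i; rfl
    | succ m ih => intro y i; rw [pow_succ, pow_succ]; exact ih (diag A y) i
  have diag_aeval : ∀ (p : Polynomial ℂ) y i,
      Polynomial.aeval (diag A) p y i = Polynomial.aeval (A i) p (y i) := by
    intro p y i
    rw [Polynomial.aeval_eq_sum_range, Polynomial.aeval_eq_sum_range, sum_apply, sum_apply]
    simp only [WithLp.ofLp_sum, Finset.sum_apply, smul_apply, PiLp.smul_apply, diag_pow]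
  let u : ι → PiLp 2 G := fun i => PiLp.single 2 i (x i)
  have hu_apply : ∀ i k, u i k = Pi.single i (x i) k := fun _ _ => rfl
  have hu : Orthonormal ℂ u := by
    constructor
    · intro i
      rw [PiLp.norm_single, hx]
    · intro i j hij
      simp only [PiLp.inner_apply, hu_apply]
      refine Finset.sum_eq_zero fun k _ => ?_
      rcases eq_or_ne k i with rfl | hk
      · rw [Pi.single_eq_of_ne hij, inner_zero_right]
      · rw [Pi.single_eq_of_ne hk, inner_zero_left]
  have hdu : ∀ (B : ∀ i, G i →L[ℂ] G i) i, ‖diag B (u i)‖ = ‖B i (x i)‖ := by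
    intro B i
    have : diag B (u i) = PiLp.single 2 i (B i (x i)) := by
      ext k
      rw [diag_apply, hu_apply]
      exact Pi.apply_single (fun i => B i) (fun i => map_zero _) i (x i) k
    rw [this, PiLp.norm_single]
  have := sum_norm_sq_sub_norm_adjoint_sq_le_of_approx (diag A) diag_le hu ?_
  · simp_rw [diag_adjoint, hdu] at this
    exact this.trans (by gcongr)
  · intro ε hε
    let s : ℝ := Real.sqrt (Fintype.card ι) + 1
    have hs : 0 < s := by positivity
    obtain ⟨w, hw⟩ := h (ε / s) (by positivity)
    refine ⟨e.symm w, fun i => ?_⟩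
    obtain ⟨p, hp⟩ := hw i
    refine ⟨p, ?_⟩
    refine lt_of_pow_lt_pow_left₀ 2 hε.le ?_
    rw [PiLp.norm_sq_eq_of_L2]
    calc ∑ k, ‖(Polynomial.aeval (diag A) p (e.symm w) - u i) k‖ ^ 2
        ≤ ∑ k : ι, (ε / s) ^ 2 := by
          refine Finset.sum_le_sum fun k _ => ?_
          rw [PiLp.sub_apply, diag_aeval, hu_apply]
          have := (hp k).le
          gcongr
          exact this
      _ = Fintype.card ι * (ε / s) ^ 2 := by simp
      _ < s ^ 2 * (ε / s) ^ 2 := by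
          gcongr
          nlinarith [Real.sq_sqrt (Nat.cast_nonneg (α := ℝ) (Fintype.card ι)),
            Real.sqrt_nonneg (Fintype.card ι)]
      _ = ε ^ 2 := by field_simp

theorem tendsto_pow_zero_of_spectrum_subset_ball {B : Type*} [NormedRing B] [NormedAlgebra ℂ B]
    [CompleteSpace B] {a : B} (ha : spectrum ℂ a ⊆ Metric.ball 0 1) :
    Filter.Tendsto (fun n : ℕ => a ^ n) Filter.atTop (nhds 0) := by
  nontriviality B
  have h1 : spectralRadius ℂ a < (1 : NNReal) :=
    spectrum.spectralRadius_lt_of_forall_lt a fun z hz => by simpa using! ha hz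
  obtain ⟨r, hr, hr1⟩ := ENNReal.lt_iff_exists_nnreal_btwn.1 h1
  have hr1' : r < 1 := by exact_mod_cast hr1
  have hev := (spectrum.pow_nnnorm_pow_one_div_tendsto_nhds_spectralRadius a).eventually
    (gt_mem_nhds hr)
  rw [tendsto_zero_iff_norm_tendsto_zero]
  refine squeeze_zero' (Filter.Eventually.of_forall fun _ => norm_nonneg _) ?_
    (tendsto_pow_atTop_nhds_zero_of_lt_one r.2 hr1')
  filter_upwards [hev, Filter.eventually_gt_atTop 0] with n hn hn0
  have hn0' : (0 : ℝ) < n := by exact_mod_cast hn0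
  have h2 : (‖a ^ n‖₊ : ENNReal) ≤ (r : ENNReal) ^ (n : ℝ) := by
    rw [← ENNReal.rpow_one (‖a ^ n‖₊ : ENNReal), ← one_div_mul_cancel hn0'.ne', ENNReal.rpow_mul]
    exact ENNReal.rpow_le_rpow hn.le hn0'.le
  rw [ENNReal.rpow_natCast] at h2
  exact_mod_cast h2

theorem tendsto_inverse_one_sub_pow_of_spectrum_subset_ball {B : Type*} [NormedRing B]
    [NormedAlgebra ℂ B] [CompleteSpace B] {a : B} (ha : spectrum ℂ a ⊆ Metric.ball 0 1) :
    (∀ᶠ n : ℕ in Filter.atTop, IsUnit (1 - a ^ n)) ∧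
      Filter.Tendsto (fun n : ℕ => Ring.inverse (1 - a ^ n)) Filter.atTop (nhds 1) := by
  have h : Filter.Tendsto (fun n : ℕ => 1 - a ^ n) Filter.atTop (nhds ((1 : Bˣ) : B)) := by
    simpa using (tendsto_pow_zero_of_spectrum_subset_ball ha).const_sub 1
  refine ⟨h.eventually (Units.nhds 1), ?_⟩
  simpa [Function.comp_def] using (NormedRing.inverse_continuousAt (1 : Bˣ)).tendsto.comp h

theorem tendsto_inverse_one_sub_pow_of_disjoint_spectrum {B : Type*} [NormedRing B]
    [NormedAlgebra ℂ B] [CompleteSpace B] {a : B}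
    (ha : Disjoint (spectrum ℂ a) (Metric.closedBall 0 1)) :
    (∀ᶠ n : ℕ in Filter.atTop, IsUnit (1 - a ^ n)) ∧
      Filter.Tendsto (fun n : ℕ => Ring.inverse (1 - a ^ n)) Filter.atTop (nhds 0) := by
  have ha0 : IsUnit a := by
    rw [← spectrum.zero_notMem_iff ℂ]
    exact fun h0 => Set.disjoint_left.1 ha h0 (by simp)
  obtain ⟨a, rfl⟩ := ha0
  have hinv : spectrum ℂ (↑a⁻¹ : B) ⊆ Metric.ball 0 1 := by
    intro z hz
    have hz' := spectrum.inv₀_mem_iff.2 hz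
    have hz1 : 1 < ‖z⁻¹‖ := by
      by_contra! hle
      exact Set.disjoint_left.1 ha hz' (by simpa using hle)
    rw [norm_inv] at hz1
    have hzpos : 0 < ‖z‖ := inv_pos.1 (zero_lt_one.trans hz1)
    simpa using (one_lt_inv₀ hzpos).1 hz1
  obtain ⟨hu, hl⟩ := tendsto_inverse_one_sub_pow_of_spectrum_subset_ball hinv
  have hfac : ∀ n : ℕ, (1 - (a : B) ^ n) = -((a ^ n : Bˣ) : B) * (1 - (↑a⁻¹ : B) ^ n) := by
    intro n
    have : (a : B) ^ n * (↑a⁻¹ : B) ^ n = 1 := by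
      rw [← Units.val_pow_eq_pow_val, ← Units.val_pow_eq_pow_val, ← Units.val_mul, inv_pow,
        mul_inv_cancel, Units.val_one]
    rw [Units.val_pow_eq_pow_val, neg_mul, mul_sub, this]
    simp
  have hfac' : ∀ n : ℕ, IsUnit (1 - (↑a⁻¹ : B) ^ n) → IsUnit (1 - (a : B) ^ n) := by
    intro n hn
    rw [hfac]
    exact (a ^ n).isUnit.neg.mul hn
  refine ⟨hu.mono hfac', ?_⟩
  have hlim : Filter.Tendsto (fun n : ℕ => Ring.inverse (1 - (↑a⁻¹ : B) ^ n) * -(↑a⁻¹ : B) ^ n)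
      Filter.atTop (nhds 0) := by
    simpa using hl.mul (tendsto_pow_zero_of_spectrum_subset_ball hinv).neg
  refine hlim.congr' ?_
  filter_upwards [hu] with n hn
  refine (hfac' n hn).mul_right_cancel ?_
  rw [Ring.inverse_mul_cancel _ (hfac' n hn), hfac, mul_assoc, ← mul_assoc (-(↑a⁻¹ : B) ^ n)]
  rw [← Units.val_pow_eq_pow_val, neg_mul_neg, ← Units.val_mul, inv_pow, inv_mul_cancel,
    Units.val_one, one_mul, ← inv_pow, Units.val_pow_eq_pow_val, Ring.inverse_mul_cancel _ hn]

theorem exists_polynomial_separating {κ : Type*} [Fintype κ] [DecidableEq κ]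
    {G : Option κ → Type*} [∀ i, NormedAddCommGroup (G i)] [∀ i, InnerProductSpace ℂ (G i)]
    [∀ i, CompleteSpace (G i)] (A : ∀ i, G i →L[ℂ] G i) (x : ∀ i, G i)
    (g : κ → Polynomial ℂ)
    (hin : ∀ j, spectrum ℂ (Polynomial.aeval (A (some j)) (g j)) ⊆ Metric.ball 0 1)
    (hout : ∀ j i, i ≠ some j →
      Disjoint (spectrum ℂ (Polynomial.aeval (A i) (g j))) (Metric.closedBall 0 1))
    {ε : ℝ} (hε : 0 < ε) :
    ∃ w : ∀ i, G i, ∀ i, ∃ p : Polynomial ℂ,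
      ∀ k, ‖Polynomial.aeval (A k) p (w k) - Pi.single i (x i) k‖ < ε := by
  let b (n : ℕ) (j : κ) : Polynomial ℂ := 1 - g j ^ n
  let q (n : ℕ) : Polynomial ℂ := ∏ j, b n j
  let p (n : ℕ) (j : κ) : Polynomial ℂ := ∏ j' ∈ Finset.univ.erase j, b n j'
  let w (n : ℕ) (i : Option κ) : G i := Ring.inverse (Polynomial.aeval (A i) (q n)) (x i)
  have hb : ∀ n j i, Polynomial.aeval (A i) (b n j) = 1 - Polynomial.aeval (A i) (g j) ^ n :=
    fun n j i => by simp [b]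
  have hunit : ∀ i, ∀ᶠ n in Filter.atTop, ∀ j, IsUnit (Polynomial.aeval (A i) (b n j)) := by
    intro i
    rw [Filter.eventually_all]
    intro j
    simp_rw [hb]
    by_cases hij : i = some j
    · subst hij
      exact (tendsto_inverse_one_sub_pow_of_spectrum_subset_ball (hin j)).1
    · exact (tendsto_inverse_one_sub_pow_of_disjoint_spectrum (hout j i hij)).1
  have hlim : ∀ i j, Filter.Tendsto
      (fun n => Ring.inverse (Polynomial.aeval (A i) (b n j)) (x i)) Filter.atTop
      (nhds (Pi.single (some j) (x (some j)) i)) := by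
    intro i j
    simp_rw [hb]
    by_cases hij : i = some j
    · subst hij
      rw [Pi.single_eq_same]
      exact ((ContinuousLinearMap.apply ℂ _ (x (some j))).continuous.tendsto _).comp
        (tendsto_inverse_one_sub_pow_of_spectrum_subset_ball (hin j)).2
    · rw [Pi.single_eq_of_ne hij]
      exact ((ContinuousLinearMap.apply ℂ _ (x i)).continuous.tendsto _).comp
        (tendsto_inverse_one_sub_pow_of_disjoint_spectrum (hout j i hij)).2
  have hprod : ∀ i (s : Finset κ) n, (∀ j, IsUnit (Polynomial.aeval (A i) (b n j))) →
      IsUnit (Polynomial.aeval (A i) (∏ j ∈ s, b n j)) := by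
    intro i s n hn
    induction s using Finset.induction_on with
    | empty => simp
    | insert j s hj ih =>
      rw [Finset.prod_insert hj, map_mul]
      exact (hn j).mul ih
  have hpw : ∀ i j, Filter.Tendsto (fun n => Polynomial.aeval (A i) (p n j) (w n i))
      Filter.atTop (nhds (Pi.single (some j) (x (some j)) i)) := by
    intro i j
    refine (hlim i j).congr' ?_
    filter_upwards [hunit i] with n hn
    have h1 : Ring.inverse (Polynomial.aeval (A i) (b n j))
        = Polynomial.aeval (A i) (p n j) * Ring.inverse (Polynomial.aeval (A i) (q n)) := by
      refine (hn j).mul_left_cancel ?_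
      rw [Ring.mul_inverse_cancel _ (hn j), ← mul_assoc, ← map_mul,
        Finset.mul_prod_erase Finset.univ (b n) (Finset.mem_univ j),
        Ring.mul_inverse_cancel _ (hprod i _ n hn)]
    rw [h1]
    rfl
  have hqw : ∀ i, Filter.Tendsto (fun n => Polynomial.aeval (A i) (q n - ∑ j, p n j) (w n i))
      Filter.atTop (nhds (Pi.single none (x none) i)) := by
    intro i
    have h1 : Filter.Tendsto (fun n => x i - ∑ j, Polynomial.aeval (A i) (p n j) (w n i))
        Filter.atTop (nhds (x i - ∑ j, Pi.single (some j) (x (some j)) i)) :=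
      (tendsto_finsetSum _ fun j _ => hpw i j).const_sub _
    have h2 : x i - ∑ j, Pi.single (some j) (x (some j)) i = Pi.single none (x none) i := by
      cases i with
      | none => simp
      | some i =>
        rw [Finset.sum_eq_single i, Pi.single_eq_same, Pi.single_eq_of_ne (by simp), sub_self]
        · intro j _ hj
          rw [Pi.single_eq_of_ne]
          simpa using hj.symm
        · simp
    rw [h2] at h1
    refine h1.congr' ?_
    filter_upwards [hunit i] with n hn
    have h3 : Polynomial.aeval (A i) (q n) (w n i) = x i := by
      change (Polynomial.aeval (A i) (q n) * Ring.inverse (Polynomial.aeval (A i) (q n))) (x i) = _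
      rw [Ring.mul_inverse_cancel _ (hprod i _ n hn)]
      rfl
    rw [map_sub, map_sum, sub_apply, sum_apply, h3]
  let P (n : ℕ) (i : Option κ) : Polynomial ℂ := i.elim (q n - ∑ j, p n j) (p n)
  have hP : ∀ i k, ∀ᶠ n in Filter.atTop,
      ‖Polynomial.aeval (A k) (P n i) (w n k) - Pi.single i (x i) k‖ < ε := by
    intro i k
    have : Filter.Tendsto (fun n => Polynomial.aeval (A k) (P n i) (w n k))
        Filter.atTop (nhds (Pi.single i (x i) k)) := by
      cases i with
      | none => exact hqw k
      | some j => exact hpw k j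
    exact (tendsto_iff_norm_sub_tendsto_zero.1 this).eventually (gt_mem_nhds hε)
  simp_rw [← Filter.eventually_all] at hP
  obtain ⟨n, hn⟩ := hP.exists
  exact ⟨w n, fun i => ⟨P n i, hn i⟩⟩

theorem spectrum_aeval_C_mul_X_sub_C_subset {B : Type*} [Ring B] [Algebra ℂ B] (a : B) (c : ℂ)
    {ρ : ℝ} (hρ : 0 < ρ) {z : ℂ}
    (hz : z ∈ spectrum ℂ (Polynomial.aeval a
      (Polynomial.C (ρ : ℂ)⁻¹ * (Polynomial.X - Polynomial.C c)))) :
    ∃ y ∈ spectrum ℂ a, ‖z‖ = dist y c / ρ := by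
  have hρ0 : (ρ : ℂ)⁻¹ ≠ 0 := inv_ne_zero (by exact_mod_cast hρ.ne')
  rw [spectrum.map_polynomial_aeval_of_degree_pos] at hz
  · obtain ⟨y, hy, rfl⟩ := hz
    refine ⟨y, hy, ?_⟩
    simp [dist_eq_norm, abs_of_pos hρ, div_eq_inv_mul]
  · rw [Polynomial.degree_C_mul hρ0, Polynomial.degree_X_sub_C]
    exact zero_lt_one

theorem exists_isometry_adjoint_apply_eq_zero :
    ∃ (S : Type u) (_ : NormedAddCommGroup S) (_ : InnerProductSpace ℂ S) (_ : CompleteSpace S)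
      (V : S →L[ℂ] S) (e : S), (∀ y, ‖V y‖ = ‖y‖) ∧ ‖e‖ = 1 ∧ adjoint V e = 0 := by
  classical
  let b : ℕ → lp (fun _ : ULift.{u} ℕ => ℂ) 2 := fun n => lp.single 2 (ULift.up n) (1 : ℂ)
  have hb : Orthonormal ℂ b := by
    rw [orthonormal_iff_ite]
    intro i j
    rw [lp.inner_single_left]
    by_cases hij : i = j
    · simp [b, hij]
    · simp [b, hij]
  let v : ULift.{u} ℕ → lp (fun _ : ULift.{u} ℕ => ℂ) 2 := fun n => b (n.down + 1)
  have hv : Orthonormal ℂ v := hb.comp _ fun m n hmn => ULift.ext _ _ (Nat.succ_injective hmn)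
  let V := hv.orthogonalFamily.linearIsometry
  refine ⟨lp (fun _ : ULift.{u} ℕ => ℂ) 2, inferInstance, inferInstance, inferInstance, V.toContinuousLinearMap, b 0,
    V.norm_map, hb.1 0, ?_⟩
  refine ext_inner_right ℂ fun y => ?_
  rw [adjoint_inner_left, inner_zero_left]
  have hsum := (hv.orthogonalFamily.hasSum_linearIsometry y).mapL (innerSL ℂ (b 0))
  refine hsum.unique ?_
  convert hasSum_zero with n
  simp [v, hb.2 (Nat.succ_ne_zero n.down).symm]

theorem norm_sq_sub_norm_adjoint_sq_smul_one_add_smul {S : Type*} [NormedAddCommGroup S]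
    [InnerProductSpace ℂ S] [CompleteSpace S] (V : S →L[ℂ] S) (a : ℂ) (r : ℝ) (y : S) :
    ‖(a • 1 + (r : ℂ) • V) y‖ ^ 2 - ‖adjoint (a • 1 + (r : ℂ) • V) y‖ ^ 2
      = r ^ 2 * (‖V y‖ ^ 2 - ‖adjoint V y‖ ^ 2) := by
  have hadj : adjoint (a • 1 + (r : ℂ) • V)
      = (starRingEnd ℂ a) • 1 + (r : ℂ) • adjoint V := by
    rw [map_add, map_smulₛₗ, map_smulₛₗ, Complex.conj_ofReal, ← star_eq_adjoint, star_one]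
  have hre : RCLike.re (inner ℂ ((starRingEnd ℂ a) • y) ((r : ℂ) • adjoint V y))
      = RCLike.re (inner ℂ (a • y) ((r : ℂ) • V y)) := by
    rw [inner_smul_left, inner_smul_right, inner_smul_left, inner_smul_right, adjoint_inner_right,
      ← inner_conj_symm (V y) y, ← RCLike.conj_re]
    simp
  rw [hadj]
  simp only [add_apply, smul_apply, one_apply_eq_self]
  rw [norm_add_sq (𝕜 := ℂ), norm_add_sq (𝕜 := ℂ), hre]
  simp only [norm_smul, RCLike.norm_conj, mul_pow, Complex.norm_real, Real.norm_eq_abs, sq_abs]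
  ring

theorem exists_disjoint_closedBall_sum_sq_gt {K : Set ℂ} (hK : IsClosed K) (hK0 : volume K = 0)
    {R : ℝ} (hR : 0 < R) {ε : ℝ} (hε : 0 < ε) :
    ∃ (s : Finset ℂ) (ρ : ℂ → ℝ), (∀ c ∈ s, 0 < ρ c) ∧
      (∀ c ∈ s, Disjoint K (Metric.closedBall c (ρ c))) ∧ (∀ c ∈ s, ‖c‖ + ρ c ≤ R) ∧
      (s : Set ℂ).PairwiseDisjoint (fun c => Metric.closedBall c (ρ c)) ∧
      R ^ 2 - ε < ∑ c ∈ s, ρ c ^ 2 := by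
  obtain ⟨t, ρ, htc, hts, htρ, hcov, hdisj⟩ := Besicovitch.exists_disjoint_closedBall_covering_ae
    (volume : Measure ℂ) (fun c => {ρ | Disjoint K (Metric.closedBall c ρ) ∧ ‖c‖ + ρ ≤ R})
    (Metric.ball 0 R \ K) (by
      rintro c ⟨hcR, hcK⟩ δ hδ
      obtain ⟨η, hη, hηK⟩ := Metric.nhds_basis_closedBall.mem_iff.1 (hK.isOpen_compl.mem_nhds hcK)
      rw [mem_ball_zero_iff] at hcR
      have hm : 0 < min η (min (R - ‖c‖) (δ / 2)) := by
        have := sub_pos.2 hcR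
        positivity
      refine ⟨min η (min (R - ‖c‖) (δ / 2)), ⟨?_, ?_⟩, hm, ?_⟩
      · exact (Set.subset_compl_iff_disjoint_left.1
          ((Metric.closedBall_subset_closedBall (min_le_left _ _)).trans hηK))
      · linarith [(min_le_right η (min (R - ‖c‖) (δ / 2))).trans (min_le_left _ _)]
      · linarith [(min_le_right η (min (R - ‖c‖) (δ / 2))).trans (min_le_right _ _)])
    (fun _ => 1) (fun _ _ => one_pos)
  have hvol : volume (Metric.ball (0 : ℂ) R)
      ≤ ∑' c : t, volume (Metric.closedBall (c : ℂ) (ρ c)) := by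
    calc volume (Metric.ball (0 : ℂ) R)
        = volume (Metric.ball (0 : ℂ) R \ K) := (measure_sdiff_null hK0).symm
      _ ≤ volume ((Metric.ball (0 : ℂ) R \ K) \ ⋃ c ∈ t, Metric.closedBall c (ρ c))
            + volume (⋃ c ∈ t, Metric.closedBall c (ρ c)) := by
          refine (measure_mono ?_).trans (measure_union_le _ _)
          rw [Set.sdiff_union_self]
          exact Set.subset_union_left
      _ ≤ ∑' c : t, volume (Metric.closedBall (c : ℂ) (ρ c)) := by
          rw [hcov, zero_add]
          exact measure_biUnion_le _ htc _
  simp_rw [Complex.volume_ball, Complex.volume_closedBall] at hvol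
  rw [ENNReal.tsum_mul_right, ENNReal.mul_le_mul_iff_left (by simp [NNReal.pi_ne_zero])
    ENNReal.coe_ne_top] at hvol
  have hlt : ENNReal.ofReal (R ^ 2 - ε) < ∑' c : t, ENNReal.ofReal (ρ c) ^ 2 := by
    refine lt_of_lt_of_le ?_ hvol
    rw [← ENNReal.ofReal_pow hR.le]
    exact (ENNReal.ofReal_lt_ofReal_iff (by positivity)).2 (by linarith)
  rw [ENNReal.tsum_eq_iSup_sum, lt_iSup_iff] at hlt
  obtain ⟨s, hs⟩ := hlt
  have hst : ∀ c ∈ s.map (Function.Embedding.subtype _), c ∈ t := by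
    intro c hc
    obtain ⟨c, _, rfl⟩ := Finset.mem_map.1 hc
    exact c.2
  refine ⟨s.map (Function.Embedding.subtype _), ρ, fun c hc => (htρ c (hst c hc)).2.1,
    fun c hc => (htρ c (hst c hc)).1.1, fun c hc => (htρ c (hst c hc)).1.2,
    hdisj.subset hst, ?_⟩
  rw [Finset.sum_map]
  have hs' : ∑ c ∈ s, ENNReal.ofReal (ρ c) ^ 2 = ENNReal.ofReal (∑ c ∈ s, ρ c ^ 2) := by
    rw [ENNReal.ofReal_sum_of_nonneg fun _ _ => sq_nonneg _]
    exact Finset.sum_congr rfl fun c _ => (ENNReal.ofReal_pow (htρ c c.2).2.1.le 2).symm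
  rw [hs'] at hs
  exact (ENNReal.ofReal_lt_ofReal_iff').1 hs |>.1

theorem norm_sq_sub_norm_adjoint_sq_add_sum_sq_le {H : Type u} [NormedAddCommGroup H]
    [InnerProductSpace ℂ H] [CompleteSpace H] (T : H →L[ℂ] H)
    (hT : ∀ y, ‖adjoint T y‖ ≤ ‖T y‖) {R : ℝ} (hR : ‖T‖ ≤ R) {x : H} (hx : ‖x‖ = 1)
    {κ : Type*} [Fintype κ] (c : κ → ℂ) (r ρ : κ → ℝ) (hr : ∀ j, 0 ≤ r j)
    (hrρ : ∀ j, r j < ρ j) (hρR : ∀ j, ‖c j‖ + ρ j ≤ R)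
    (hdisj : Pairwise fun i j =>
      Disjoint (Metric.closedBall (c i) (ρ i)) (Metric.closedBall (c j) (ρ j)))
    (hspec : ∀ j, Disjoint (spectrum ℂ T) (Metric.closedBall (c j) (ρ j))) :
    ‖T x‖ ^ 2 - ‖adjoint T x‖ ^ 2 + ∑ j, r j ^ 2 ≤ R ^ 2 := by
  classical
  obtain ⟨S, _, _, _, V, e, hV, he, hVe⟩ := exists_isometry_adjoint_apply_eq_zero.{u}
  have hρ : ∀ j, 0 < ρ j := fun j => (hr j).trans_lt (hrρ j)
  have hV1 : ‖V‖ ≤ 1 := V.opNorm_le_bound zero_le_one fun y => by rw [hV, one_mul]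
  let B : κ → S →L[ℂ] S := fun j => c j • 1 + (r j : ℂ) • V
  have hBspec : ∀ j, spectrum ℂ (B j) ⊆ Metric.closedBall (c j) (r j) := by
    intro j z hz
    have h1 : z - c j ∈ spectrum ℂ ((r j : ℂ) • V) := by
      rw [spectrum.mem_iff] at hz ⊢
      convert hz using 2
      rw [map_sub, Algebra.algebraMap_eq_smul_one (c j), sub_sub]
    rw [mem_closedBall_iff_norm]
    calc ‖z - c j‖ ≤ ‖(r j : ℂ) • V‖ * ‖(1 : S →L[ℂ] S)‖ := spectrum.norm_le_norm_mul_of_mem h1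
      _ ≤ r j * 1 * 1 := by
        rw [norm_smul, Complex.norm_real, Real.norm_of_nonneg (hr j)]
        gcongr
        · exact mul_nonneg (hr j) zero_le_one
        · exact hr j
        · exact (norm_id_le : ‖ContinuousLinearMap.id ℂ S‖ ≤ 1)
      _ = r j := by ring
  have hBnorm : ∀ j, ‖B j‖ ≤ R := by
    intro j
    refine le_trans ?_ (hρR j)
    refine (norm_add_le _ _).trans (add_le_add ?_ ?_)
    · rw [norm_smul]
      exact mul_le_of_le_one_right (norm_nonneg _) norm_id_le
    · rw [norm_smul, Complex.norm_real, Real.norm_of_nonneg (hr j)]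
      exact (mul_le_of_le_one_right (hr j) hV1).trans (hrρ j).le
  have hBhypo : ∀ j y, ‖adjoint (B j) y‖ ≤ ‖B j y‖ := by
    intro j y
    have h1 := norm_sq_sub_norm_adjoint_sq_smul_one_add_smul V (c j) (r j) y
    have h2 : ‖adjoint V y‖ ≤ ‖V y‖ := by
      rw [hV]
      refine ((adjoint V).le_of_opNorm_le ?_ y).trans_eq (one_mul _)
      rwa [LinearIsometryEquiv.norm_map]
    refine le_of_sq_le_sq ?_ (norm_nonneg _)
    rw [← sub_nonneg, h1]
    refine mul_nonneg (sq_nonneg _) (sub_nonneg.2 ?_)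
    gcongr
  have hBe : ∀ j, ‖B j e‖ ^ 2 - ‖adjoint (B j) e‖ ^ 2 = r j ^ 2 := by
    intro j
    rw [norm_sq_sub_norm_adjoint_sq_smul_one_add_smul, hV, he, hVe]
    simp
  let G : Option κ → Type u := fun i => match i with | none => H | some _ => S
  let : ∀ i, NormedAddCommGroup (G i) := fun i => match i with
    | none => inferInstanceAs (NormedAddCommGroup H)
    | some _ => inferInstanceAs (NormedAddCommGroup S)
  let : ∀ i, InnerProductSpace ℂ (G i) := fun i => match i with
    | none => inferInstanceAs (InnerProductSpace ℂ H)
    | some _ => inferInstanceAs (InnerProductSpace ℂ S)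
  have : ∀ i, CompleteSpace (G i) := fun i => match i with
    | none => inferInstanceAs (CompleteSpace H)
    | some _ => inferInstanceAs (CompleteSpace S)
  let A : ∀ i, G i →L[ℂ] G i := fun i => match i with | none => T | some j => B j
  let y : ∀ i, G i := fun i => match i with | none => x | some _ => e
  have hAball : ∀ j i, i ≠ some j →
      Disjoint (spectrum ℂ (A i)) (Metric.closedBall (c j) (ρ j)) := by
    rintro j (_ | i) hij
    · exact hspec j
    · refine (hdisj (fun h => hij (congrArg some h))).mono_left ?_
      exact (hBspec i).trans (Metric.closedBall_subset_closedBall (hrρ i).le)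
  have key := sum_norm_sq_sub_norm_adjoint_sq_le_of_blocks A
    (by rintro (_ | j); exacts [hT, hBhypo j]) ((norm_nonneg T).trans hR)
    (by rintro (_ | j); exacts [hR, hBnorm j]) (x := y)
    (by rintro (_ | j); exacts [hx, he])
    (fun ε hε => exists_polynomial_separating A y
      (fun j => Polynomial.C (ρ j : ℂ)⁻¹ * (Polynomial.X - Polynomial.C (c j))) ?_ ?_ hε)
  · rw [Fintype.sum_option] at key
    refine le_trans (le_of_eq ?_) key
    congr 1
    exact Finset.sum_congr rfl fun j _ => (hBe j).symm
  · intro j z hz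
    obtain ⟨w, hw, hzw⟩ := spectrum_aeval_C_mul_X_sub_C_subset _ _ (hρ j) hz
    rw [mem_ball_zero_iff, hzw, div_lt_one (hρ j)]
    exact (Metric.mem_closedBall.1 (hBspec j hw)).trans_lt (hrρ j)
  · intro j i hij
    rw [Set.disjoint_left]
    intro z hz hz1
    obtain ⟨w, hw, hzw⟩ := spectrum_aeval_C_mul_X_sub_C_subset _ _ (hρ j) hz
    rw [mem_closedBall_zero_iff, hzw, div_le_one (hρ j)] at hz1
    exact Set.disjoint_left.1 (hAball j i hij) hw hz1

theorem norm_sq_le_norm_adjoint_sq_of_volume_spectrum_eq_zero {H : Type*} [NormedAddCommGroup H]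
    [InnerProductSpace ℂ H] [CompleteSpace H] (T : H →L[ℂ] H)
    (hT : ∀ y, ‖adjoint T y‖ ≤ ‖T y‖) (hspec : volume (spectrum ℂ T) = 0) {x : H}
    (hx : ‖x‖ = 1) : ‖T x‖ ^ 2 - ‖adjoint T x‖ ^ 2 ≤ 0 := by
  set R : ℝ := ‖T‖ + 1
  have hR : 0 < R := by positivity
  have key : ∀ ε ∈ Set.Ioo (0 : ℝ) 1,
      ‖T x‖ ^ 2 - ‖adjoint T x‖ ^ 2 ≤ R ^ 2 - (1 - ε) ^ 2 * (R ^ 2 - ε) := by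
    rintro ε ⟨hε, hε1⟩
    obtain ⟨s, ρ, hρ, hρK, hρR, hdisj, hsum⟩ :=
      exists_disjoint_closedBall_sum_sq_gt (spectrum.isClosed T) hspec hR hε
    have h1 := norm_sq_sub_norm_adjoint_sq_add_sum_sq_le T hT (le_add_of_nonneg_right zero_le_one)
      hx (fun c : s => (c : ℂ)) (fun c => (1 - ε) * ρ c) (fun c => ρ c)
      (fun c => mul_nonneg (by linarith) (hρ c c.2).le)
      (fun c => mul_lt_of_lt_one_left (hρ c c.2) (by linarith)) (fun c => hρR c c.2)
      (fun c d hcd => hdisj c.2 d.2 (Subtype.coe_ne_coe.2 hcd)) (fun c => hρK c c.2)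
    simp_rw [mul_pow] at h1
    rw [← Finset.mul_sum, Finset.sum_coe_sort s fun c => ρ c ^ 2] at h1
    have h2 := mul_le_mul_of_nonneg_left hsum.le (sq_nonneg (1 - ε))
    linarith
  have hcont : Continuous fun ε : ℝ => R ^ 2 - (1 - ε) ^ 2 * (R ^ 2 - ε) := by fun_prop
  have hlim := (hcont.tendsto 0).mono_left (nhdsWithin_le_nhds (s := Set.Ioi 0))
  simp only [sub_zero, one_pow, one_mul, sub_self] at hlim
  refine ge_of_tendsto hlim ?_
  filter_upwards [Ioo_mem_nhdsGT one_pos] with ε hε using key ε hε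

/-- A hyponormal operator whose spectrum has planar Lebesgue measure zero is
normal. -/
theorem stmt_17 {H : Type*} [NormedAddCommGroup H] [InnerProductSpace ℂ H]
    [CompleteSpace H] (T : H →L[ℂ] H)
    (hhypo : (adjoint T ∘L T - T ∘L adjoint T).IsPositive)
    (hspec : volume (spectrum ℂ T) = 0) :
    T ∘L adjoint T = adjoint T ∘L T := by
  have hT : ∀ y, ‖adjoint T y‖ ≤ ‖T y‖ := by
    intro y
    have h := hhypo.re_inner_nonneg_right y
    rw [sub_apply, inner_sub_right, comp_apply, comp_apply, adjoint_inner_right,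
      ← adjoint_inner_left T (adjoint T y) y, map_sub, inner_self_eq_norm_sq,
      inner_self_eq_norm_sq, sub_nonneg] at h
    exact le_of_sq_le_sq h (norm_nonneg _)
  have hnormal : IsStarNormal T := by
    rw [isStarNormal_iff_norm_eq_adjoint]
    intro v
    refine le_antisymm ?_ (hT v)
    rcases eq_or_ne v 0 with rfl | hv
    · simp
    have hv0 : 0 < ‖v‖ := norm_pos_iff.2 hv
    have h := norm_sq_le_norm_adjoint_sq_of_volume_spectrum_eq_zero T hT hspec
      (norm_smul_inv_norm (𝕜 := ℂ) hv)
    rw [map_smul, map_smul, norm_smul, norm_smul, sub_nonpos] at h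
    have h' := le_of_sq_le_sq h (by positivity)
    refine le_of_mul_le_mul_left h' ?_
    rw [norm_pos_iff]
    simpa using hv
  exact hnormal.star_comm_self.eq.symm
end
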